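/- arXiv:1902.04774 — 2 statements merged into one kernel-verified Lean document; each statement's English description precedes it below -/
import Mathlib

section
/- Fix n, m ≥ 1, T ≥ 1, a doubly stochastic matrix W ∈ ℝ^{n×n} with nonnegative entries and σ := ‖W − (1/n)𝟏𝟏ᵀ‖ < 1, and data h_i(t) ∈ ℝ^m with h_i(t) ≠ 0 and z_i(t) ∈ ℝ for all i, t, such that S* = {y ∈ ℝ^m : h_i(t)ᵀy = z_i(t) for all i, t} is nonempty. Run DOELR: x_i(t+1) = ∑_{j=1}^n W_{ij}·(x_j(t) − h_j(t)(h_j(t)ᵀx_j(t) − z_j(t))/‖h_j(t)‖²). Let p be the orthogonal projection of x̄(1) = (1/n)∑_i x_i(1) onto S* and D = ∑_i ‖x_i(1) − p‖². Then ∑_{t=1}^T ∑_{i=1}^n ‖x_i(t) − x̄(t)‖ ≤ P₁ + P₂·√T, where P₁ = ∑_i ‖x_i(1) − x̄(1)‖ + √n·(σ/(1−σ))·∑_i ‖x_i(1)‖ and P₂ = n·(σ/(1−σ))·√D. -/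
open MeasureTheory ProbabilityTheory Finset
open scoped RealInnerProductSpace Pointwise

noncomputable section

/-- `ℝ^m` with the Euclidean norm. -/
abbrev Euc (m : ℕ) := EuclideanSpace ℝ (Fin m)

/-- The square loss `θ(y) = (1/2)(hᵀy − z)²`. -/
def sqLoss {m : ℕ} (h : Euc m) (z : ℝ) (y : Euc m) : ℝ := (1/2) * (⟪h, y⟫ - z)^2

/-- The gradient `h (hᵀy − z)` of the square loss at `y`. -/
def sqLossGrad {m : ℕ} (h : Euc m) (z : ℝ) (y : Euc m) : Euc m := (⟪h, y⟫ - z) • h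

/-- A matrix is doubly stochastic: nonnegative entries, every row and column sums to 1. -/
def DoublyStochastic {n : ℕ} (W : Matrix (Fin n) (Fin n) ℝ) : Prop :=
  (∀ i j, 0 ≤ W i j) ∧ (∀ i, ∑ j, W i j = 1) ∧ (∀ j, ∑ i, W i j = 1)

/-- Operator norm of a matrix, induced by the Euclidean norm on `ℝ^n`. -/
def matOpNorm {n : ℕ} (M : Matrix (Fin n) (Fin n) ℝ) : ℝ :=
  ‖LinearMap.toContinuousLinearMap (Matrix.toEuclideanLin M)‖

/-- The averaging matrix `(1/n) 𝟏𝟏ᵀ`. -/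
def avgMatrix (n : ℕ) : Matrix (Fin n) (Fin n) ℝ := Matrix.of fun _ _ => (n : ℝ)⁻¹

theorem norm_toLp_matrix_smul_le {n m : ℕ} (M : Matrix (Fin n) (Fin n) ℝ) (v : Fin n → Euc m) :
    ‖WithLp.toLp 2 (fun i => ∑ j, M i j • v j)‖ ≤ matOpNorm M * ‖WithLp.toLp 2 v‖ := by
  have hM : 0 ≤ matOpNorm M := norm_nonneg _
  have hcol (k : Fin m) :
      ∑ i, (∑ j, M i j * v j k) ^ 2 ≤ matOpNorm M ^ 2 * ∑ j, v j k ^ 2 := by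
    have hle := (LinearMap.toContinuousLinearMap (Matrix.toEuclideanLin M)).le_opNorm
      (WithLp.toLp 2 fun j => v j k)
    have hsq := pow_le_pow_left₀ (norm_nonneg _) hle 2
    rw [mul_pow, EuclideanSpace.norm_sq_eq, EuclideanSpace.norm_sq_eq] at hsq
    simpa [Matrix.mulVec, dotProduct, matOpNorm, sq_abs] using hsq
  refine le_of_sq_le_sq ?_ (by positivity)
  rw [mul_pow, PiLp.norm_sq_eq_of_L2, PiLp.norm_sq_eq_of_L2]
  simp only [EuclideanSpace.norm_sq_eq, Real.norm_eq_abs, sq_abs]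
  rw [Finset.sum_comm, Finset.sum_comm (f := fun j k => v j k ^ 2), Finset.mul_sum]
  exact Finset.sum_le_sum fun k _ => by simpa using hcol k

theorem norm_sub_projection_sq {m : ℕ} {h : Euc m} (hh : h ≠ 0) {z : ℝ} {p : Euc m}
    (hp : ⟪h, p⟫ = z) (x : Euc m) :
    ‖x - (‖h‖ ^ 2)⁻¹ • sqLossGrad h z x - p‖ ^ 2
      = ‖x - p‖ ^ 2 - ‖(‖h‖ ^ 2)⁻¹ • sqLossGrad h z x‖ ^ 2 := by
  have hn : ‖h‖ ≠ 0 := norm_ne_zero_iff.mpr hh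
  rw [sub_right_comm, norm_sub_sq_real, sqLossGrad, smul_smul, inner_smul_right,
    norm_smul, Real.norm_eq_abs, mul_pow, sq_abs, real_inner_comm h (x - p), inner_sub_right, hp]
  field_simp
  ring

theorem DoublyStochastic.sum_norm_sq_le {n m : ℕ} {W : Matrix (Fin n) (Fin n) ℝ}
    (hW : DoublyStochastic W) (y : Fin n → Euc m) (p : Euc m) :
    ∑ i, ‖∑ j, W i j • y j - p‖ ^ 2 ≤ ∑ j, ‖y j - p‖ ^ 2 := by
  obtain ⟨hnn, hrow, hcol⟩ := hW
  have hconv : ConvexOn ℝ Set.univ fun v : Euc m => ‖v‖ ^ 2 :=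
    (convexOn_norm convex_univ).pow (fun _ _ => norm_nonneg _) 2
  have hJ (i : Fin n) : ‖∑ j, W i j • y j - p‖ ^ 2 ≤ ∑ j, W i j * ‖y j - p‖ ^ 2 := by
    have := hconv.map_sum_le (t := Finset.univ) (w := W i) (p := fun j => y j - p)
      (fun j _ => hnn i j) (hrow i) (fun _ _ => Set.mem_univ _)
    simpa [smul_sub, Finset.sum_sub_distrib, ← Finset.sum_smul, hrow i] using this
  calc ∑ i, ‖∑ j, W i j • y j - p‖ ^ 2
      ≤ ∑ i, ∑ j, W i j * ‖y j - p‖ ^ 2 := Finset.sum_le_sum fun i _ => hJ i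
    _ = ∑ j, ‖y j - p‖ ^ 2 := by
      rw [Finset.sum_comm]
      simp only [← Finset.sum_mul, hcol, one_mul]

theorem DoublyStochastic.sum_smul_sub_average {n m : ℕ} {W : Matrix (Fin n) (Fin n) ℝ}
    (hW : DoublyStochastic W) (hn : 1 ≤ n) (y : Fin n → Euc m) (c : Euc m) (i : Fin n) :
    ∑ j, W i j • y j - (n : ℝ)⁻¹ • ∑ l, ∑ j, W l j • y j
      = ∑ j, (W - avgMatrix n) i j • (y j - c) := by
  obtain ⟨-, hrow, hcol⟩ := hW
  have hn' : (n : ℝ) ≠ 0 := by positivity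
  have hsum : ∑ j, (W - avgMatrix n) i j = 0 := by
    simp [avgMatrix, hrow, hn']
  simp only [smul_sub, Finset.sum_sub_distrib, ← Finset.sum_smul, hsum, zero_smul, sub_zero]
  rw [Finset.sum_comm (f := fun l j => W l j • y j)]
  simp [avgMatrix, ← Finset.sum_smul, hcol, sub_smul, Finset.sum_sub_distrib, Finset.smul_sum]

theorem sum_norm_le_sqrt_mul_norm_toLp {n m : ℕ} (v : Fin n → Euc m) :
    ∑ i, ‖v i‖ ≤ Real.sqrt n * ‖WithLp.toLp 2 v‖ := by
  refine le_of_sq_le_sq ?_ (by positivity)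
  rw [mul_pow, Real.sq_sqrt (by positivity), PiLp.norm_sq_eq_of_L2]
  simpa using sq_sum_le_card_mul_sum_sq (s := Finset.univ) (f := fun i => ‖v i‖)

theorem norm_toLp_sub_average_le {n m : ℕ} (hn : 1 ≤ n) (v : Fin n → Euc m) :
    ‖WithLp.toLp 2 (fun i => v i - (n : ℝ)⁻¹ • ∑ l, v l)‖ ≤ ∑ i, ‖v i‖ := by
  set c := (n : ℝ)⁻¹ • ∑ l, v l with hc
  have hn' : (n : ℝ) ≠ 0 := by positivity
  have hsum : ∑ l, v l = (n : ℝ) • c := by rw [hc, smul_inv_smul₀ hn']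
  refine le_of_sq_le_sq ?_ (by positivity)
  rw [PiLp.norm_sq_eq_of_L2]
  calc ∑ i, ‖v i - c‖ ^ 2 = ∑ i, ‖v i‖ ^ 2 - n * ‖c‖ ^ 2 := by
        simp only [norm_sub_sq_real, Finset.sum_add_distrib, Finset.sum_sub_distrib,
          ← Finset.mul_sum, ← sum_inner, hsum, inner_smul_left, real_inner_self_eq_norm_sq]
        simp
        ring
    _ ≤ ∑ i, ‖v i‖ ^ 2 := sub_le_self _ (by positivity)
    _ ≤ (∑ i, ‖v i‖) ^ 2 :=
      Finset.sum_sq_le_sq_sum_of_nonneg fun i _ => norm_nonneg _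

theorem sum_Icc_le_of_add_le {V G : ℕ → ℝ} (hV : ∀ t, 0 ≤ V t) (T : ℕ)
    (hstep : ∀ t ∈ Finset.Icc 1 T, V (t + 1) + G t ≤ V t) :
    ∑ t ∈ Finset.Icc 1 T, G t ≤ V 1 := by
  suffices H : ∀ k ≤ T, ∑ t ∈ Finset.Icc 1 k, G t ≤ V 1 - V (k + 1) by
    linarith [H T le_rfl, hV (T + 1)]
  intro k
  induction k with
  | zero => simp
  | succ k ih =>
    intro hk
    rw [Finset.sum_Icc_succ_top (by omega)]
    linarith [ih (by omega), hstep (k + 1) (by simp; omega)]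

theorem sum_Icc_add_succ (f : ℕ → ℝ) (T : ℕ) :
    ∑ t ∈ Finset.Icc 1 T, f t + f (T + 1) = f 1 + ∑ t ∈ Finset.Icc 1 T, f (t + 1) := by
  induction T with
  | zero => simp
  | succ k ih =>
    rw [Finset.sum_Icc_succ_top (by omega), Finset.sum_Icc_succ_top (by omega)]
    linarith

theorem sum_Icc_le_of_le_mul_add {σ : ℝ} (hσ0 : 0 ≤ σ) (hσ : σ < 1) {E G : ℕ → ℝ}
    (hE : ∀ t, 0 ≤ E t) (T : ℕ)
    (hstep : ∀ t ∈ Finset.Icc 1 T, E (t + 1) ≤ σ * (E t + G t)) :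
    ∑ t ∈ Finset.Icc 1 T, E (t + 1)
      ≤ σ / (1 - σ) * (E 1 + ∑ t ∈ Finset.Icc 1 T, G t) := by
  have hshift := sum_Icc_add_succ E T
  have hsum := Finset.sum_le_sum hstep
  rw [← Finset.mul_sum, Finset.sum_add_distrib] at hsum
  have hmono : σ * ∑ t ∈ Finset.Icc 1 T, E t
      ≤ σ * (E 1 + ∑ t ∈ Finset.Icc 1 T, E (t + 1)) :=
    mul_le_mul_of_nonneg_left (by linarith [hE (T + 1)]) hσ0
  rw [div_mul_eq_mul_div, le_div_iff₀ (by linarith)]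
  linarith

/-- Lemma 5. Cumulative disagreement bound for DOELR under the
exact-regression assumption. -/
theorem doelr_disagreement_bound
    {n m T : ℕ} (hn : 1 ≤ n) (hm : 1 ≤ m) (hT : 1 ≤ T)
    (W : Matrix (Fin n) (Fin n) ℝ) (hW : DoublyStochastic W)
    (σ : ℝ) (hσdef : σ = matOpNorm (W - avgMatrix n)) (hσ : σ < 1)
    (h : Fin n → ℕ → Euc m) (z : Fin n → ℕ → ℝ)
    (hhne : ∀ i, ∀ t ∈ Finset.Icc 1 T, h i t ≠ 0)
    (hS : {y : Euc m | ∀ i, ∀ t ∈ Finset.Icc 1 T, ⟪h i t, y⟫ = z i t}.Nonempty)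
    (x : Fin n → ℕ → Euc m)
    (hrec : ∀ i, ∀ t ∈ Finset.Icc 1 T, x i (t + 1) =
      ∑ j, W i j • (x j t - (‖h j t‖ ^ 2)⁻¹ • sqLossGrad (h j t) (z j t) (x j t)))
    (p : Euc m)
    (hpS : p ∈ {y : Euc m | ∀ i, ∀ t ∈ Finset.Icc 1 T, ⟪h i t, y⟫ = z i t})
    (hpproj : ∀ y ∈ {y : Euc m | ∀ i, ∀ t ∈ Finset.Icc 1 T, ⟪h i t, y⟫ = z i t},
      dist ((n : ℝ)⁻¹ • ∑ i, x i 1) p ≤ dist ((n : ℝ)⁻¹ • ∑ i, x i 1) y)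
    (D P₁ P₂ : ℝ)
    (hD : D = ∑ i, ‖x i 1 - p‖ ^ 2)
    (hP₁ : P₁ = (∑ i, ‖x i 1 - (n : ℝ)⁻¹ • ∑ l, x l 1‖)
      + Real.sqrt n * (σ / (1 - σ)) * ∑ i, ‖x i 1‖)
    (hP₂ : P₂ = n * (σ / (1 - σ)) * Real.sqrt D) :
    ∑ t ∈ Finset.Icc 1 T, ∑ i, ‖x i t - (n : ℝ)⁻¹ • ∑ l, x l t‖
      ≤ P₁ + P₂ * Real.sqrt T := by
  have hσ0 : 0 ≤ σ := hσdef ▸ norm_nonneg _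
  have hr : 0 ≤ σ / (1 - σ) := div_nonneg hσ0 (by linarith)
  set g : Fin n → ℕ → Euc m := fun j t =>
    (‖h j t‖ ^ 2)⁻¹ • sqLossGrad (h j t) (z j t) (x j t) with hg
  set c : ℕ → Euc m := fun t => (n : ℝ)⁻¹ • ∑ l, x l t with hc
  set E : ℕ → ℝ := fun t => ‖WithLp.toLp 2 fun i => x i t - c t‖ with hE
  set G : ℕ → ℝ := fun t => ‖WithLp.toLp 2 fun i => g i t‖ with hG
  have hE0 (t : ℕ) : 0 ≤ E t := norm_nonneg _
  have hcontract : ∀ t ∈ Finset.Icc 1 T, E (t + 1) ≤ σ * (E t + G t) := by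
    intro t ht
    have heq : (fun i => x i (t + 1) - c (t + 1))
        = fun i => ∑ j, (W - avgMatrix n) i j • (x j t - g j t - c t) := by
      funext i
      rw [← hW.sum_smul_sub_average hn]
      simp only [hc, hg, hrec _ t ht]
    have hsplit : WithLp.toLp 2 (fun j => x j t - g j t - c t)
        = WithLp.toLp 2 (fun j => x j t - c t) - WithLp.toLp 2 (fun j => g j t) := by
      ext1 j
      simp [sub_right_comm]
    calc E (t + 1) ≤ σ * ‖WithLp.toLp 2 fun j => x j t - g j t - c t‖ := by
          simp only [hE, heq, hσdef]
          exact norm_toLp_matrix_smul_le _ _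
      _ ≤ σ * (E t + G t) := by
          rw [hsplit]
          exact mul_le_mul_of_nonneg_left (norm_sub_le _ _) hσ0
  have hfejer : ∀ t ∈ Finset.Icc 1 T,
      ∑ i, ‖x i (t + 1) - p‖ ^ 2 + G t ^ 2 ≤ ∑ i, ‖x i t - p‖ ^ 2 := by
    intro t ht
    have hproj : ∑ i, ‖x i t - g i t - p‖ ^ 2 = ∑ i, ‖x i t - p‖ ^ 2 - G t ^ 2 := by
      rw [PiLp.norm_sq_eq_of_L2, ← Finset.sum_sub_distrib]
      exact Finset.sum_congr rfl fun i _ =>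
        norm_sub_projection_sq (hhne i t ht) (hpS i t ht) (x i t)
    have hmix := hW.sum_norm_sq_le (fun j => x j t - g j t) p
    simp only [hrec _ t ht]
    linarith
  have hGsq : ∑ t ∈ Finset.Icc 1 T, G t ^ 2 ≤ D :=
    hD ▸ sum_Icc_le_of_add_le (V := fun t => ∑ i, ‖x i t - p‖ ^ 2)
      (fun _ => by positivity) T hfejer
  have hGsum : ∑ t ∈ Finset.Icc 1 T, G t ≤ Real.sqrt D * Real.sqrt T := by
    have hcs := sq_sum_le_card_mul_sum_sq (s := Finset.Icc 1 T) (f := G)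
    rw [Nat.card_Icc, Nat.add_sub_cancel] at hcs
    rw [← Real.sqrt_mul' _ (Nat.cast_nonneg T)]
    refine Real.le_sqrt_of_sq_le (hcs.trans ?_)
    rw [mul_comm D]
    gcongr
  have hEsum := sum_Icc_le_of_le_mul_add hσ0 hσ hE0 T hcontract
  have hE1 : E 1 ≤ ∑ i, ‖x i 1‖ := norm_toLp_sub_average_le hn fun i => x i 1
  have hsqrt : Real.sqrt n ≤ n := by
    have h1 : (1 : ℝ) ≤ n := by exact_mod_cast hn
    exact Real.sqrt_le_iff.mpr ⟨by positivity, by nlinarith⟩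
  have hshift : ∑ t ∈ Finset.Icc 1 T, ∑ i, ‖x i t - c t‖
      ≤ ∑ i, ‖x i 1 - c 1‖ + ∑ t ∈ Finset.Icc 1 T, ∑ i, ‖x i (t + 1) - c (t + 1)‖ := by
    rw [← sum_Icc_add_succ (fun t => ∑ i, ‖x i t - c t‖) T]
    exact le_add_of_nonneg_right (by positivity)
  calc ∑ t ∈ Finset.Icc 1 T, ∑ i, ‖x i t - c t‖
      ≤ ∑ i, ‖x i 1 - c 1‖ + ∑ t ∈ Finset.Icc 1 T, ∑ i, ‖x i (t + 1) - c (t + 1)‖ := hshift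
    _ ≤ ∑ i, ‖x i 1 - c 1‖ + ∑ t ∈ Finset.Icc 1 T, Real.sqrt n * E (t + 1) := by
      gcongr with t
      exact sum_norm_le_sqrt_mul_norm_toLp _
    _ ≤ ∑ i, ‖x i 1 - c 1‖ + Real.sqrt n
          * (σ / (1 - σ) * (∑ i, ‖x i 1‖ + Real.sqrt D * Real.sqrt T)) := by
      rw [← Finset.mul_sum]
      gcongr
      exact hEsum.trans (by gcongr)
    _ = P₁ + Real.sqrt n * (σ / (1 - σ) * (Real.sqrt D * Real.sqrt T)) := by
      rw [hP₁]
      ring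
    _ ≤ P₁ + n * (σ / (1 - σ) * (Real.sqrt D * Real.sqrt T)) := by
      gcongr
    _ = P₁ + P₂ * Real.sqrt T := by
      rw [hP₂]
      ring
end
end

section
/- Fix n, m ≥ 1, T ≥ 1, a doubly stochastic matrix W ∈ ℝ^{n×n} with nonnegative entries, and data h_i(t) ∈ ℝ^m with h_i(t) ≠ 0 and z_i(t) ∈ ℝ for all i ∈ {1,…,n}, t ∈ {1,…,T}, such that S* = {y ∈ ℝ^m : h_i(t)ᵀy = z_i(t) for all i, t} is nonempty. Run DOELR: x_i(t+1) = ∑_{j=1}^n W_{ij}·(x_j(t) − h_j(t)(h_j(t)ᵀx_j(t) − z_j(t))/‖h_j(t)‖²). Then for every t ∈ {1,…,T} and every y* ∈ S*: ∑_{ℓ=1}^{t} ∑_{i=1}^{n} (h_i(ℓ)ᵀx_i(ℓ) − z_i(ℓ))² / ‖h_i(ℓ)‖² ≤ ∑_{i=1}^{n} ‖x_i(1) − y*‖². -/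
open MeasureTheory ProbabilityTheory Finset
open scoped RealInnerProductSpace Pointwise

noncomputable section

/-- Pythagoras for the projection onto the hyperplane `{y | ⟪h, y⟫ = z}`. -/
theorem norm_sub_sqLossGrad_sub_sq {m : ℕ} {h : Euc m} (hh : h ≠ 0) {z : ℝ} (x : Euc m)
    {y : Euc m} (hy : ⟪h, y⟫ = z) :
    ‖x - (‖h‖ ^ 2)⁻¹ • sqLossGrad h z x - y‖ ^ 2 =
      ‖x - y‖ ^ 2 - (⟪h, x⟫ - z) ^ 2 / ‖h‖ ^ 2 := by
  have hn : ‖h‖ ≠ 0 := norm_ne_zero_iff.mpr hh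
  have hxy : ⟪x - y, h⟫ = ⟪h, x⟫ - z := by
    rw [real_inner_comm, inner_sub_right, hy]
  rw [sqLossGrad, smul_smul, sub_right_comm, norm_sub_sq_real, inner_smul_right, hxy,
    norm_smul, mul_pow, Real.norm_eq_abs, sq_abs]
  field_simp
  ring

/-- Jensen's inequality for the squared norm. -/
theorem norm_sum_smul_sq_le {ι E : Type*} [Fintype ι] [SeminormedAddCommGroup E]
    [NormedSpace ℝ E] {w : ι → ℝ} (hw : ∀ j, 0 ≤ w j) (hw1 : ∑ j, w j = 1) (v : ι → E) :
    ‖∑ j, w j • v j‖ ^ 2 ≤ ∑ j, w j * ‖v j‖ ^ 2 :=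
  ((convexOn_univ_norm (E := E)).pow (fun _ _ => norm_nonneg _) 2).map_sum_le
    (fun j _ => hw j) hw1 (fun _ _ => Set.mem_univ _)

/-- Averaging with a doubly stochastic matrix does not increase the sum of squared distances
to a point. -/
theorem DoublyStochastic.sum_norm_sum_smul_sub_sq_le {n : ℕ} {E : Type*}
    [SeminormedAddCommGroup E] [NormedSpace ℝ E] {W : Matrix (Fin n) (Fin n) ℝ}
    (hW : DoublyStochastic W) (v : Fin n → E) (y : E) :
    ∑ i, ‖∑ j, W i j • v j - y‖ ^ 2 ≤ ∑ j, ‖v j - y‖ ^ 2 := by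
  obtain ⟨hnonneg, hrow, hcol⟩ := hW
  calc ∑ i, ‖∑ j, W i j • v j - y‖ ^ 2
      = ∑ i, ‖∑ j, W i j • (v j - y)‖ ^ 2 := by
        simp only [smul_sub, Finset.sum_sub_distrib, ← Finset.sum_smul, hrow, one_smul]
    _ ≤ ∑ i, ∑ j, W i j * ‖v j - y‖ ^ 2 :=
        Finset.sum_le_sum fun i _ => norm_sum_smul_sq_le (hnonneg i) (hrow i) _
    _ = ∑ j, ‖v j - y‖ ^ 2 := by
        rw [Finset.sum_comm]
        simp only [← Finset.sum_mul, hcol, one_mul]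

/-- Monotone projection inequality for DOELR: the cumulative squared
distances to the sampled hyperplanes are bounded by the initial squared distance to any
exact solution. -/
theorem doelr_projection_inequality
    {n m T : ℕ} (hn : 1 ≤ n) (hm : 1 ≤ m) (hT : 1 ≤ T)
    (W : Matrix (Fin n) (Fin n) ℝ) (hW : DoublyStochastic W)
    (h : Fin n → ℕ → Euc m) (z : Fin n → ℕ → ℝ)
    (hhne : ∀ i, ∀ t ∈ Finset.Icc 1 T, h i t ≠ 0)
    (hS : {y : Euc m | ∀ i, ∀ t ∈ Finset.Icc 1 T, ⟪h i t, y⟫ = z i t}.Nonempty)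
    (x : Fin n → ℕ → Euc m)
    (hrec : ∀ i, ∀ t ∈ Finset.Icc 1 T, x i (t + 1) =
      ∑ j, W i j • (x j t - (‖h j t‖ ^ 2)⁻¹ • sqLossGrad (h j t) (z j t) (x j t))) :
    ∀ t ∈ Finset.Icc 1 T,
      ∀ ystar ∈ {y : Euc m | ∀ i, ∀ t' ∈ Finset.Icc 1 T, ⟪h i t', y⟫ = z i t'},
        ∑ l ∈ Finset.Icc 1 t, ∑ i, (⟪h i l, x i l⟫ - z i l) ^ 2 / ‖h i l‖ ^ 2
          ≤ ∑ i, ‖x i 1 - ystar‖ ^ 2 := by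
  intro t ht y hy
  have hstep : ∀ l ∈ Finset.Icc 1 T, ∑ i, ‖x i (l + 1) - y‖ ^ 2 ≤
      ∑ i, ‖x i l - y‖ ^ 2 - ∑ i, (⟪h i l, x i l⟫ - z i l) ^ 2 / ‖h i l‖ ^ 2 := by
    intro l hl
    rw [← Finset.sum_sub_distrib]
    simp only [hrec _ l hl]
    refine (hW.sum_norm_sum_smul_sub_sq_le _ y).trans_eq (Finset.sum_congr rfl fun i _ => ?_)
    exact norm_sub_sqLossGrad_sub_sq (hhne i l hl) _ (hy i l hl)
  have htelescope : ∀ s ≤ T,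
      ∑ l ∈ Finset.Icc 1 s, ∑ i, (⟪h i l, x i l⟫ - z i l) ^ 2 / ‖h i l‖ ^ 2
        + ∑ i, ‖x i (s + 1) - y‖ ^ 2 ≤ ∑ i, ‖x i 1 - y‖ ^ 2 := by
    intro s
    induction s with
    | zero => simp
    | succ s ih =>
      intro hs
      rw [Finset.sum_Icc_succ_top (by omega)]
      have hnext := hstep (s + 1) (Finset.mem_Icc.mpr ⟨by omega, hs⟩)
      have hprev := ih (by omega)
      linarith
  have hlast : 0 ≤ ∑ i, ‖x i (t + 1) - y‖ ^ 2 := by positivity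
  linarith [htelescope t (Finset.mem_Icc.mp ht).2]
end
end
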